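/- Let v : 2^S → ℝ satisfy gross substitutes, let p ∈ ℝ^S be any price vector, and let ℓ ∈ ℕ with ℓ ≤ |S|. Then there is a matroid on ground set S whose bases are exactly the bundles T with |T| = ℓ that maximize u(T,p) among all bundles of size ℓ; equivalently, this family of maximizers is nonempty and satisfies the basis exchange property: for any two such maximizers T1 ≠ T2 and any j1 ∈ T1 ∖ T2 there exists j2 ∈ T2 ∖ T1 such that (T1 ∪ {j2}) ∖ {j1} is also a maximizer. -/

import Mathlib

open Finset

variable {S : Type*}

/-- Quasilinear utility of bundle `T` at prices `p`. -/
def qUtil [DecidableEq S] (v : Finset S → ℝ) (p : S → ℝ) (T : Finset S) : ℝ :=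
  v T - ∑ j ∈ T, p j

/-- `T` is a demanded set at prices `p`. -/
def Demands [DecidableEq S] (v : Finset S → ℝ) (p : S → ℝ) (T : Finset S) : Prop :=
  ∀ T' : Finset S, qUtil v p T' ≤ qUtil v p T

/-- Gross substitutes: if prices (weakly) increase, every demanded set keeps, inside some
new demanded set, all its items whose price did not change. -/
def GrossSubstitutes [DecidableEq S] (v : Finset S → ℝ) : Prop :=
  ∀ p p' : S → ℝ, (∀ j, p j ≤ p' j) →
    ∀ T : Finset S, Demands v p T →
      ∃ T' : Finset S, Demands v p' T' ∧ ∀ j ∈ T, p j = p' j → j ∈ T'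

/-- `T` maximizes the quasilinear utility among bundles of size `ℓ`. -/
def IsSizeMax [DecidableEq S] (v : Finset S → ℝ) (p : S → ℝ) (ℓ : ℕ) (T : Finset S) : Prop :=
  T.card = ℓ ∧ ∀ T' : Finset S, T'.card = ℓ → qUtil v p T' ≤ qUtil v p T

open Filter Topology in
/-- Every face, in direction `w`, of the demand at `q` is the demand at some other prices. -/
lemma exists_demands_face [Fintype S] [DecidableEq S] (v : Finset S → ℝ) (q w : S → ℝ) :
    ∃ q' : S → ℝ, ∀ T, Demands v q' T ↔
      Demands v q T ∧ ∀ T', Demands v q T' → ∑ j ∈ T', w j ≤ ∑ j ∈ T, w j := by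
  classical
  obtain ⟨T₁, -, hT₁⟩ := exists_max_image (univ : Finset (Finset S)) (qUtil v q) univ_nonempty
  obtain ⟨T₀, hT₀, hw⟩ := exists_max_image
    (univ.filter fun T => Demands v q T) (fun T => ∑ j ∈ T, w j)
    ⟨T₁, mem_filter.2 ⟨mem_univ _, fun T => hT₁ T (mem_univ _)⟩⟩
  simp only [mem_filter, mem_univ, true_and] at hT₀ hw
  have hev : ∀ᶠ ε : ℝ in 𝓝[>] 0, ∀ T, ¬ Demands v q T →
      qUtil v q T + ε * ∑ j ∈ T, w j < qUtil v q T₀ + ε * ∑ j ∈ T₀, w j := by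
    refine eventually_all.2 fun T => ?_
    by_cases hT : Demands v q T
    · exact Eventually.of_forall fun _ h => absurd hT h
    have hlt : qUtil v q T < qUtil v q T₀ := by
      by_contra! h
      exact hT fun T' => (hT₀ T').trans h
    have hl : ContinuousAt (fun ε : ℝ => qUtil v q T + ε * ∑ j ∈ T, w j) 0 := by fun_prop
    have hr : ContinuousAt (fun ε : ℝ => qUtil v q T₀ + ε * ∑ j ∈ T₀, w j) 0 := by fun_prop
    have := hl.eventually_lt hr (by simpa using hlt)
    exact (this.filter_mono nhdsWithin_le_nhds).mono fun _ h _ => h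
  obtain ⟨ε, hε, hpos⟩ := (hev.and self_mem_nhdsWithin).exists
  have hpos : 0 < ε := hpos
  have hu : ∀ T, qUtil v (fun j => q j - ε * w j) T = qUtil v q T + ε * ∑ j ∈ T, w j := by
    intro T
    simp only [qUtil, sum_sub_distrib, mul_sum]
    ring
  refine ⟨fun j => q j - ε * w j, fun T => ⟨fun hT => ?_, fun hT T' => ?_⟩⟩
  · have h₀ := hT T₀
    rw [hu, hu] at h₀
    have hTq : Demands v q T := by
      by_contra h
      exact absurd (hε T h) (not_lt.2 h₀)
    refine ⟨hTq, fun T' hT' => (hw T' hT').trans ?_⟩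
    have := hT₀ T
    exact le_of_mul_le_mul_left (by linarith) hpos
  · rw [hu, hu]
    have hwT := mul_le_mul_of_nonneg_left (hT.2 T₀ hT₀) hpos.le
    have hT0 := hT.1 T₀
    by_cases hT' : Demands v q T'
    · have := mul_le_mul_of_nonneg_left (hT.2 T' hT') hpos.le
      have := hT.1 T'
      linarith
    · have := hε T' hT'
      linarith

/-- A demanded set `X` can give up any `R ⊆ X \ Y`, staying below `X ∪ Y`, when `Y` is demanded. -/
lemma GrossSubstitutes.exists_demands_avoiding [DecidableEq S] {v : Finset S → ℝ}
    (hv : GrossSubstitutes v) {q : S → ℝ} {X Y R : Finset S} (hX : Demands v q X)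
    (hY : Demands v q Y) (hR : R ⊆ X \ Y) :
    ∃ Z, Demands v q Z ∧ X \ R ⊆ Z ∧ Z ⊆ (X ∪ Y) \ R := by
  set P : S → Prop := fun j => j ∈ R ∨ j ∉ X ∪ Y with hP
  set q' : S → ℝ := fun j => q j + if P j then 1 else 0 with hq'
  have hu : ∀ T, qUtil v q' T = qUtil v q T - ((T.filter P).card : ℝ) := by
    intro T
    simp only [qUtil, hq', sum_add_distrib, sum_boole]
    ring
  obtain ⟨Z, hZ, hXZ⟩ := hv q q' (fun j => by simp only [hq']; split_ifs <;> simp) X hX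
  have hY0 : Y.filter P = ∅ := by
    ext j
    have := @hR j
    simp only [hP, mem_filter, mem_sdiff, mem_union, notMem_empty] at *
    tauto
  have hZY := hZ Y
  rw [hu, hu, hY0] at hZY
  have hYZ := hY Z
  simp only [card_empty, Nat.cast_zero, sub_zero] at hZY
  have hcard : ((Z.filter P).card : ℝ) = 0 :=
    le_antisymm (by linarith) (Nat.cast_nonneg _)
  have hZ0 : Z.filter P = ∅ := card_eq_zero.1 (by exact_mod_cast hcard)
  refine ⟨Z, fun T => (hY T).trans (by linarith), fun j hj => ?_, fun j hj => ?_⟩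
  · rw [mem_sdiff] at hj
    refine hXZ j hj.1 ?_
    have : ¬ P j := by simp [hP, hj.1, hj.2]
    simp [hq', this]
  · have : ¬ P j := fun h => by
      have : j ∈ Z.filter P := mem_filter.2 ⟨hj, h⟩
      simp [hZ0] at this
    simp only [hP, not_or, not_not] at this
    exact mem_sdiff.2 ⟨this.2, this.1⟩

lemma exists_demands_between [Fintype S] [DecidableEq S] {v : Finset S → ℝ} {q : S → ℝ}
    {X Y : Finset S} (hX : Demands v q X) :
    ∃ q' : S → ℝ, ∀ T, Demands v q' T ↔ Demands v q T ∧ X ∩ Y ⊆ T ∧ T ⊆ X ∪ Y := by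
  set w : S → ℝ := fun j => (if j ∈ X ∩ Y then 1 else 0) - if j ∉ X ∪ Y then 1 else 0 with hw
  have hsum : ∀ T, ∑ j ∈ T, w j = ((T ∩ (X ∩ Y)).card : ℝ) - ((T \ (X ∪ Y)).card : ℝ) := by
    intro T
    rw [hw, sum_sub_distrib, sum_boole, sum_boole, filter_mem_eq_inter, filter_notMem_eq_sdiff]
  have hbetween : ∀ T, X ∩ Y ⊆ T → T ⊆ X ∪ Y → ∑ j ∈ T, w j = ((X ∩ Y).card : ℝ) := by
    intro T h₁ h₂
    rw [hsum, inter_eq_right.2 h₁, sdiff_eq_empty_iff_subset.2 h₂]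
    simp
  have hle : ∀ T, ((T ∩ (X ∩ Y)).card : ℝ) ≤ ((X ∩ Y).card : ℝ) := fun T => by
    exact_mod_cast card_le_card inter_subset_right
  obtain ⟨q', hq'⟩ := exists_demands_face v q w
  refine ⟨q', fun T => (hq' T).trans (and_congr_right fun _ => ⟨fun h => ?_, fun h T' _ => ?_⟩)⟩
  · have h := h X hX
    rw [hbetween X inter_subset_left subset_union_left, hsum] at h
    have h₁ := hle T
    have h₂ : (0 : ℝ) ≤ ((T \ (X ∪ Y)).card : ℝ) := Nat.cast_nonneg _
    have h₃ : ((T \ (X ∪ Y)).card : ℝ) = 0 := by linarith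
    have h₄ : (X ∩ Y).card ≤ (T ∩ (X ∩ Y)).card := by
      rw [← Nat.cast_le (α := ℝ)]
      linarith
    refine ⟨inter_eq_right.1 (eq_of_subset_of_card_le inter_subset_right h₄),
      sdiff_eq_empty_iff_subset.1 (card_eq_zero.1 (by exact_mod_cast h₃))⟩
  · rw [hbetween T h.1 h.2, hsum]
    have := hle T'
    have h₂ : (0 : ℝ) ≤ ((T' \ (X ∪ Y)).card : ℝ) := Nat.cast_nonneg _
    linarith

/-- If `X` and `Y` form an edge of the demand, exposed by a weight constant on `X \ Y` and on
`Y \ X`, then `Y` has at most one item outside `X`. -/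
lemma GrossSubstitutes.card_sdiff_le_one [Fintype S] [DecidableEq S] {v : Finset S → ℝ}
    (hv : GrossSubstitutes v) {q : S → ℝ} {X Y : Finset S} (hX : Demands v q X)
    (hY : Demands v q Y) {a b : ℝ} (hab : a * (X \ Y).card = b * (Y \ X).card)
    (hlt : ∀ W, Demands v q W → X ∩ Y ⊆ W → W ⊆ X ∪ Y → W ≠ X → W ≠ Y →
      a * (W ∩ (X \ Y)).card + b * (W ∩ (Y \ X)).card < a * (X \ Y).card) :
    (Y \ X).card ≤ 1 := by
  obtain ⟨q₁, hq₁⟩ := exists_demands_between (Y := Y) hX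
  set w : S → ℝ := fun j => (if j ∈ X \ Y then a else 0) + if j ∈ Y \ X then b else 0 with hw
  have hsum : ∀ T, ∑ j ∈ T, w j = a * (T ∩ (X \ Y)).card + b * (T ∩ (Y \ X)).card := by
    intro T
    rw [hw, sum_add_distrib, sum_ite_mem, sum_ite_mem]
    simp [mul_comm]
  have hwX : ∑ j ∈ X, w j = a * (X \ Y).card := by
    rw [hsum, inter_eq_right.2 sdiff_subset, inter_sdiff_self]
    simp
  have hwY : ∑ j ∈ Y, w j = a * (X \ Y).card := by
    rw [hsum, inter_eq_right.2 sdiff_subset, inter_sdiff_self, hab]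
    simp
  obtain ⟨q₂, hq₂⟩ := exists_demands_face v q₁ w
  have hmax : ∀ T', Demands v q₁ T' → ∑ j ∈ T', w j ≤ a * (X \ Y).card := by
    intro T' hT'
    obtain ⟨h₁, h₂, h₃⟩ := (hq₁ T').1 hT'
    by_cases hTX : T' = X
    · rw [hTX, hwX]
    by_cases hTY : T' = Y
    · rw [hTY, hwY]
    rw [hsum]
    exact (hlt T' h₁ h₂ h₃ hTX hTY).le
  have hX₁ : Demands v q₁ X := (hq₁ X).2 ⟨hX, inter_subset_left, subset_union_left⟩
  have hY₁ : Demands v q₁ Y := (hq₁ Y).2 ⟨hY, inter_subset_right, subset_union_right⟩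
  have hX₂ : Demands v q₂ X := (hq₂ X).2 ⟨hX₁, by rwa [hwX]⟩
  have hY₂ : Demands v q₂ Y := (hq₂ Y).2 ⟨hY₁, by rwa [hwY]⟩
  rcases (Y \ X).eq_empty_or_nonempty with h | ⟨y, hy⟩
  · simp [h]
  obtain ⟨Z, hZ, hYZ, hZR⟩ := hv.exists_demands_avoiding hY₂ hX₂ (singleton_subset_iff.2 hy)
  have hyZ : y ∉ Z := fun h => by simpa using hZR h
  obtain ⟨hZ₁, hZw⟩ := (hq₂ Z).1 hZ
  obtain ⟨h₁, h₂, h₃⟩ := (hq₁ Z).1 hZ₁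
  have hZX : Z = X := by
    by_contra hne
    have hZY : Z ≠ Y := fun h => hyZ (h ▸ (mem_sdiff.1 hy).1)
    have := hlt Z h₁ h₂ h₃ hne hZY
    have := hZw X hX₁
    rw [hwX, hsum] at this
    linarith
  rw [card_le_one]
  have key : ∀ c ∈ Y \ X, c = y := by
    intro c hc
    rw [mem_sdiff] at hc
    by_contra hcy
    exact hc.2 (hZX ▸ hYZ (mem_sdiff.2 ⟨hc.1, by simpa using hcy⟩))
  exact fun c hc d hd => (key c hc).trans (key d hd).symm

lemma card_eq_of_between [DecidableEq S] {X Y W : Finset S} (h₁ : X ∩ Y ⊆ W) (h₂ : W ⊆ X ∪ Y) :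
    W.card = (X ∩ Y).card + (W ∩ (X \ Y)).card + (W ∩ (Y \ X)).card := by
  rw [← card_union_of_disjoint, ← card_union_of_disjoint]
  · congr 1
    ext j
    have := @h₁ j
    have := @h₂ j
    simp only [mem_union, mem_inter, mem_sdiff] at *
    tauto
  · rw [disjoint_left]
    intro j
    simp only [mem_union, mem_inter, mem_sdiff]
    tauto
  · rw [disjoint_left]
    intro j
    simp only [mem_inter, mem_sdiff]
    tauto

/-- Augmentation: a demanded set can be enlarged by one item of any larger demanded set. -/
lemma GrossSubstitutes.exists_demands_insert [Fintype S] [DecidableEq S] {v : Finset S → ℝ}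
    (hv : GrossSubstitutes v) {q : S → ℝ} {Z T : Finset S} (hZ : Demands v q Z)
    (hT : Demands v q T) (hcard : Z.card < T.card) :
    ∃ y ∈ T \ Z, Demands v q (insert y Z) := by
  classical
  obtain ⟨Y, hY, hmin⟩ := exists_min_image
    (univ.filter fun Y => Demands v q Y ∧ Z ∩ T ⊆ Y ∧ Y ⊆ Z ∪ T ∧ Z.card < Y.card)
    (fun Y => (Z \ Y).card + (Y \ Z).card)
    ⟨T, by simp [hT, hcard]⟩
  simp only [mem_filter, mem_univ, true_and] at hY hmin
  obtain ⟨hYd, hY₁, hY₂, hYc⟩ := hY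
  have huniq : ∀ W, Demands v q W → Z ∩ Y ⊆ W → W ⊆ Z ∪ Y → Z.card < W.card → W = Y := by
    intro W hW h₁ h₂ hc
    have hZT : Z ∩ T ⊆ Z ∩ Y := subset_inter inter_subset_left hY₁
    have hle := hmin W ⟨hW, hZT.trans h₁, h₂.trans (union_subset subset_union_left hY₂), hc⟩
    have hs₁ : Z \ W ⊆ Z \ Y := fun j => by
      have := @h₁ j
      simp only [mem_inter, mem_sdiff] at *
      tauto
    have hs₂ : W \ Z ⊆ Y \ Z := fun j => by
      have := @h₂ j
      simp only [mem_union, mem_sdiff] at *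
      tauto
    have hc₁ := card_le_card hs₁
    have hc₂ := card_le_card hs₂
    have he₁ := eq_of_subset_of_card_le hs₁ (by omega)
    have he₂ := eq_of_subset_of_card_le hs₂ (by omega)
    ext j
    have := Finset.ext_iff.1 he₁ j
    have := Finset.ext_iff.1 he₂ j
    simp only [mem_sdiff] at *
    tauto
  have hmn := card_sdiff_lt_card_sdiff_iff.2 hYc
  have hone : (Y \ Z).card ≤ 1 := by
    rcases Nat.eq_zero_or_pos (Z \ Y).card with hm | hm
    · by_contra! hn
      obtain ⟨y, hy⟩ : (Y \ Z).Nonempty := card_pos.1 (by omega)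
      obtain ⟨W, hW, hYW, hWR⟩ := hv.exists_demands_avoiding hYd hZ (singleton_subset_iff.2 hy)
      have hZY : Z ⊆ Y := sdiff_eq_empty_iff_subset.1 (card_eq_zero.1 hm)
      have hc := card_le_card hYW
      rw [card_sdiff_of_subset (singleton_subset_iff.2 (mem_sdiff.1 hy).1), card_singleton] at hc
      have hc' := card_sdiff_of_subset hZY
      have hyW : y ∉ W := fun h => by simpa using hWR h
      have hWY : W = Y := by
        refine huniq W hW (fun j hj => hYW ?_) (fun j hj => ?_) (by omega)
        · rw [mem_inter] at hj
          rw [mem_sdiff] at hy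
          exact mem_sdiff.2 ⟨hj.2, fun h => hy.2 (mem_singleton.1 h ▸ hj.1)⟩
        · rw [union_comm]
          exact (mem_sdiff.1 (hWR hj)).1
      exact absurd (mem_sdiff.1 hy).1 (hWY ▸ hyW)
    · refine hv.card_sdiff_le_one hZ hYd (mul_comm ((Y \ Z).card : ℝ) ((Z \ Y).card : ℝ)) ?_
      intro W hW h₁ h₂ hWZ hWY
      have hWc : W.card ≤ Z.card := by
        by_contra! h
        exact hWY (huniq W hW h₁ h₂ h)
      have hcW := card_eq_of_between h₁ h₂
      have hcZ := card_sdiff_add_card_inter Z Y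
      have hst : (W ∩ (Z \ Y)).card + (W ∩ (Y \ Z)).card ≤ (Z \ Y).card := by omega
      have hs : (W ∩ (Y \ Z)).card = 0 → (W ∩ (Z \ Y)).card < (Z \ Y).card := by
        intro ht
        by_contra! h
        have hsub : Z \ Y ⊆ W := inter_eq_right.1 (eq_of_subset_of_card_le inter_subset_right h)
        have hZW : Z ⊆ W := by
          rw [← sdiff_union_inter Z Y]
          exact union_subset hsub h₁
        exact hWZ (eq_of_subset_of_card_le hZW hWc).symm
      generalize (W ∩ (Y \ Z)).card = t at *
      generalize (W ∩ (Z \ Y)).card = s at *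
      generalize (Z \ Y).card = m at *
      generalize (Y \ Z).card = n at *
      norm_cast
      rcases Nat.eq_zero_or_pos t with rfl | ht
      · have := hs rfl
        simp only [mul_zero, add_zero]
        exact Nat.mul_lt_mul_of_pos_left this (by omega)
      · calc n * s + m * t < n * s + n * t := by
              have := Nat.mul_lt_mul_of_pos_right hmn ht
              omega
          _ = n * (s + t) := by ring
          _ ≤ n * m := Nat.mul_le_mul_left _ hst
  have hm : Z ⊆ Y := sdiff_eq_empty_iff_subset.1 (card_eq_zero.1 (by omega))
  obtain ⟨y, hy⟩ := card_eq_one.1 (show (Y \ Z).card = 1 by omega)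
  have hyYZ : y ∈ Y \ Z := by simp [hy]
  have hYeq : insert y Z = Y := by
    rw [insert_eq, ← hy, sdiff_union_of_subset hm]
  rw [mem_sdiff] at hyYZ
  refine ⟨y, mem_sdiff.2 ⟨?_, hyYZ.2⟩, hYeq ▸ hYd⟩
  exact (mem_union.1 (hY₂ hyYZ.1)).resolve_left hyYZ.2

/-- Exchange between demanded sets of equal size. -/
lemma GrossSubstitutes.exists_demands_swap [Fintype S] [DecidableEq S] {v : Finset S → ℝ}
    (hv : GrossSubstitutes v) {q : S → ℝ} {T₁ T₂ : Finset S} (h₁ : Demands v q T₁)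
    (h₂ : Demands v q T₂) (hcard : T₁.card = T₂.card) {i : S} (hi : i ∈ T₁ \ T₂) :
    ∃ j ∈ T₂ \ T₁, Demands v q (insert j (T₁.erase i)) := by
  classical
  obtain ⟨hi₁, hi₂⟩ := mem_sdiff.1 hi
  have hce := card_erase_of_mem hi₁
  have hpos : 0 < T₁.card := card_pos.2 ⟨i, hi₁⟩
  by_cases hE : Demands v q (T₁.erase i)
  · obtain ⟨j, hj, hd⟩ := hv.exists_demands_insert hE h₂ (by omega)
    refine ⟨j, ?_, hd⟩
    simp only [mem_sdiff, mem_erase] at hj ⊢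
    refine ⟨hj.1, fun h => hj.2 ⟨?_, h⟩⟩
    rintro rfl
    exact hi₂ hj.1
  obtain ⟨Z, hZ, hZ₁, hZ₂⟩ := hv.exists_demands_avoiding h₁ h₂ (singleton_subset_iff.2 hi)
  rw [← erase_eq] at hZ₁ hZ₂
  obtain ⟨Y, hY, hmin⟩ := exists_min_image
    (univ.filter fun Y => Demands v q Y ∧ T₁.erase i ⊆ Y ∧ Y ⊆ (T₁ ∪ T₂).erase i) card
    ⟨Z, by simp [hZ, hZ₁, hZ₂]⟩
  simp only [mem_filter, mem_univ, true_and] at hY hmin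
  obtain ⟨hYd, hY₁, hY₂⟩ := hY
  have hiY : i ∉ Y := fun h => by simpa using hY₂ h
  have hTY : T₁ \ Y = {i} := by
    ext j
    have := @hY₁ j
    simp only [mem_erase, mem_sdiff, mem_singleton] at *
    constructor
    · tauto
    · rintro rfl
      exact ⟨hi₁, hiY⟩
  have hYT : Y \ T₁ ⊆ T₂ \ T₁ := fun j => by
    have := @hY₂ j
    simp only [mem_erase, mem_sdiff, mem_union] at *
    tauto
  have hYeq : Y = (Y \ T₁) ∪ T₁.erase i := by
    ext j
    have := Finset.ext_iff.1 hTY j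
    simp only [mem_erase, mem_sdiff, mem_union, mem_singleton] at *
    tauto
  have hone : (Y \ T₁).card ≤ 1 := by
    refine hv.card_sdiff_le_one h₁ hYd (a := -(Y \ T₁).card) (b := -1) (by simp [hTY]) ?_
    intro W hW hW₁ hW₂ hWT hWY
    rw [hTY, card_singleton]
    have hEW : T₁.erase i ⊆ W := fun j hj =>
      hW₁ (mem_inter.2 ⟨mem_of_mem_erase hj, hY₁ hj⟩)
    by_cases hiW : i ∈ W
    · have hTW : T₁ ⊆ W := by
        rw [← insert_erase hi₁]
        exact insert_subset hiW hEW
      have hp : 0 < (W ∩ (Y \ T₁)).card := by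
        rw [card_pos]
        by_contra h
        rw [not_nonempty_iff_eq_empty] at h
        refine hWT (Subset.antisymm (fun j hj => ?_) hTW)
        by_contra hjT
        have hjY := (mem_union.1 (hW₂ hj)).resolve_left hjT
        have : j ∈ W ∩ (Y \ T₁) := mem_inter.2 ⟨hj, mem_sdiff.2 ⟨hjY, hjT⟩⟩
        simp [h] at this
      have hp' : (0 : ℝ) < (W ∩ (Y \ T₁)).card := by exact_mod_cast hp
      rw [inter_singleton_of_mem hiW, card_singleton]
      linarith
    · have hWsub : W ⊆ Y := fun j hj => by
        have hne : j ≠ i := fun h => hiW (h ▸ hj)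
        exact (mem_union.1 (hW₂ hj)).elim (fun h => hY₁ (mem_erase.2 ⟨hne, h⟩)) id
      exact absurd (eq_of_subset_of_card_le hWsub
        (hmin W ⟨hW, hEW, hWsub.trans hY₂⟩)) hWY
  rcases (Y \ T₁).eq_empty_or_nonempty with h | h
  · rw [h, empty_union] at hYeq
    exact absurd (hYeq ▸ hYd) hE
  · obtain ⟨j, hj⟩ := card_eq_one.1 (le_antisymm hone (card_pos.2 h))
    refine ⟨j, hYT (by simp [hj]), ?_⟩
    rw [insert_eq, ← hj, ← hYeq]
    exact hYd

lemma qUtil_add_const [DecidableEq S] (v : Finset S → ℝ) (p : S → ℝ) (c : ℝ) (T : Finset S) :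
    qUtil v (fun j => p j + c) T = qUtil v p T - c * T.card := by
  simp only [qUtil, sum_add_distrib, sum_const, nsmul_eq_mul]
  ring

/-- Under a suitable uniform price shift, some set of the prescribed size is demanded. -/
lemma GrossSubstitutes.exists_demands_card_eq [Fintype S] [DecidableEq S] {v : Finset S → ℝ}
    (hv : GrossSubstitutes v) (p : S → ℝ) {ℓ : ℕ} (h₀ : 0 < ℓ) (hℓ : ℓ < Fintype.card S) :
    ∃ c : ℝ, ∃ T : Finset S, T.card = ℓ ∧ Demands v (fun j => p j + c) T := by
  classical
  set r : Finset S → Finset S → ℝ := fun Y X =>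
    (qUtil v p Y - qUtil v p X) / ((Y.card : ℝ) - X.card) with hr
  have hsmall : ∀ Y : Finset S, ∃ X : Finset S, X.card < ℓ ∧
      ∀ X' : Finset S, X'.card < ℓ → r Y X ≤ r Y X' := fun Y => by
    obtain ⟨X, hX, h⟩ := exists_min_image
      (univ.filter fun X : Finset S => X.card < ℓ) (r Y) ⟨∅, by simpa using h₀⟩
    simp only [mem_filter, mem_univ, true_and] at hX h
    exact ⟨X, hX, h⟩
  choose f hf hfmin using hsmall
  obtain ⟨Y, hY, hYmax⟩ := exists_max_image
    (univ.filter fun Y : Finset S => ℓ < Y.card) (fun Y => r Y (f Y))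
    ⟨univ, by simpa using hℓ⟩
  simp only [mem_filter, mem_univ, true_and] at hY hYmax
  set c := r Y (f Y)
  set q : S → ℝ := fun j => p j + c with hq
  have hgap : ∀ Y' X : Finset S, X.card < ℓ → ℓ < Y'.card → (0 : ℝ) < (Y'.card : ℝ) - X.card := by
    intro Y' X h h'
    have : (X.card : ℝ) < Y'.card := by exact_mod_cast h.trans h'
    linarith
  have hle : ∀ Y' X : Finset S, X.card < ℓ → ℓ < Y'.card → c ≤ r Y' X →
      qUtil v q X ≤ qUtil v q Y' := by
    intro Y' X h h' hcr
    rw [hr, le_div_iff₀ (hgap Y' X h h')] at hcr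
    rw [hq, qUtil_add_const, qUtil_add_const]
    linarith
  have hge : ∀ Y' X : Finset S, X.card < ℓ → ℓ < Y'.card → r Y' X ≤ c →
      qUtil v q Y' ≤ qUtil v q X := by
    intro Y' X h h' hcr
    rw [hr, div_le_iff₀ (hgap Y' X h h')] at hcr
    rw [hq, qUtil_add_const, qUtil_add_const]
    linarith
  have hXY : ∀ X : Finset S, X.card < ℓ → qUtil v q X ≤ qUtil v q Y := fun X hX =>
    hle Y X hX hY (hfmin Y X hX)
  have hYX : qUtil v q Y ≤ qUtil v q (f Y) := hge Y (f Y) (hf Y) hY le_rfl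
  have hYY : ∀ Y' : Finset S, ℓ < Y'.card → qUtil v q Y' ≤ qUtil v q Y := fun Y' hY' =>
    (hge Y' (f Y') (hf Y') hY' (hYmax Y' hY')).trans (hXY _ (hf Y'))
  refine ⟨c, ?_⟩
  obtain ⟨T, -, hT⟩ := exists_max_image (univ : Finset (Finset S)) (qUtil v q) univ_nonempty
  have hTd : Demands v q T := fun T' => hT T' (mem_univ _)
  by_cases hTc : T.card = ℓ
  · exact ⟨T, hTc, hTd⟩
  have hTY : qUtil v q T ≤ qUtil v q Y :=
    (lt_or_gt_of_ne hTc).elim (hXY T) (hYY T)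
  have hYd : Demands v q Y := fun T' => (hTd T').trans hTY
  have hXd : Demands v q (f Y) := fun T' => (hYd T').trans hYX
  obtain ⟨X, hX, hXmax⟩ := exists_max_image
    (univ.filter fun X : Finset S => Demands v q X ∧ X.card ≤ ℓ) card
    ⟨f Y, by simpa using ⟨hXd, (hf Y).le⟩⟩
  simp only [mem_filter, mem_univ, true_and] at hX hXmax
  refine ⟨X, le_antisymm hX.2 ?_, hX.1⟩
  by_contra! hlt
  obtain ⟨y, hy, hd⟩ := hv.exists_demands_insert hX.1 hYd (hlt.trans hY)
  have hci := card_insert_of_notMem (mem_sdiff.1 hy).2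
  have := hXmax _ ⟨hd, by omega⟩
  omega

/-- Under gross substitutes, the bundles of size `ℓ` maximizing utility among size-`ℓ` bundles
form the bases of a matroid: this family is nonempty and satisfies the basis exchange
property. -/
theorem sizeMaximizers_matroid
    [Fintype S] [DecidableEq S] (v : Finset S → ℝ) (hv : GrossSubstitutes v)
    (p : S → ℝ) (ℓ : ℕ) (hℓ : ℓ ≤ Fintype.card S) :
    (∃ T : Finset S, IsSizeMax v p ℓ T) ∧
      ∀ T1 T2 : Finset S, IsSizeMax v p ℓ T1 → IsSizeMax v p ℓ T2 → T1 ≠ T2 →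
        ∀ j1 ∈ T1 \ T2, ∃ j2 ∈ T2 \ T1, IsSizeMax v p ℓ (insert j2 (T1.erase j1)) := by
  refine ⟨?_, fun T₁ T₂ h₁ h₂ hne j₁ hj₁ => ?_⟩
  · obtain ⟨T, hT, hmax⟩ := exists_max_image (powersetCard ℓ (univ : Finset S)) (qUtil v p)
      (powersetCard_nonempty.2 (by simpa using hℓ))
    simp only [mem_powersetCard, subset_univ, true_and] at hT hmax
    exact ⟨T, hT, hmax⟩
  have hpos : 0 < ℓ := h₁.1 ▸ card_pos.2 ⟨j₁, (mem_sdiff.1 hj₁).1⟩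
  have hlt : ℓ < Fintype.card S := by
    rw [← h₂.1]
    exact card_lt_univ_of_notMem (mem_sdiff.1 hj₁).2
  obtain ⟨c, T, hT, hTd⟩ := hv.exists_demands_card_eq p hpos hlt
  have hd : ∀ U, IsSizeMax v p ℓ U → Demands v (fun j => p j + c) U := by
    refine fun U hU T' => (hTd T').trans ?_
    rw [qUtil_add_const, qUtil_add_const, hT, hU.1]
    linarith [hU.2 T hT]
  obtain ⟨j₂, hj₂, hswap⟩ :=
    hv.exists_demands_swap (hd _ h₁) (hd _ h₂) (h₁.1.trans h₂.1.symm) hj₁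
  have hcard : (insert j₂ (T₁.erase j₁)).card = ℓ := by
    rw [card_insert_of_notMem fun h => (mem_sdiff.1 hj₂).2 (mem_of_mem_erase h),
      card_erase_of_mem (mem_sdiff.1 hj₁).1, h₁.1]
    omega
  refine ⟨j₂, hj₂, hcard, fun T' hT' => ?_⟩
  have := hswap T'
  rw [qUtil_add_const, qUtil_add_const, hcard, hT'] at this
  linarith
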